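/- Let Q be an affine monoid of *dimension d and let 0 ≤ i ≤ d−2. Then ⋂_{G face of Q, *dim G = i} Q_G ⊆ ⋂_{G face of Q, *dim G = i+1} Q_G, and this inclusion is strict if and only if Q has a family of holes gp(F) + q with *dim F = i. -/

import Mathlib

open scoped Pointwise

/-- The lattice `ℤ^N`. -/
abbrev ZN (N : ℕ) : Type := Fin N → ℤ

/-- The subgroup of `ℤ^N` generated by a submonoid `Q`, i.e. `gp(Q)`. -/
def gp {N : ℕ} (Q : AddSubmonoid (ZN N)) : AddSubgroup (ZN N) :=
  AddSubgroup.closure (Q : Set (ZN N))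

/-- `F` is a face of the monoid `Q`. -/
def IsFace {N : ℕ} (Q F : AddSubmonoid (ZN N)) : Prop :=
  F ≤ Q ∧ ∀ a b : ZN N, a ∈ Q → b ∈ Q → (a + b ∈ F ↔ a ∈ F ∧ b ∈ F)

/-- The normalization (saturation) `sat(Q)` of `Q`:
all `q ∈ gp(Q)` such that `n • q ∈ Q` for some `n ≥ 1`. -/
def sat {N : ℕ} (Q : AddSubmonoid (ZN N)) : AddSubmonoid (ZN N) where
  carrier := {q | q ∈ gp Q ∧ ∃ n : ℕ, 1 ≤ n ∧ n • q ∈ Q}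
  zero_mem' := ⟨(gp Q).zero_mem, 1, le_refl 1, by simpa using Q.zero_mem⟩
  add_mem' := by
    rintro a b ⟨ha, n, hn, hna⟩ ⟨hb, m, hm, hmb⟩
    refine ⟨(gp Q).add_mem ha hb, n * m,
      Nat.one_le_iff_ne_zero.mpr (Nat.mul_ne_zero (by omega) (by omega)), ?_⟩
    have h1 : (n * m) • a ∈ Q := by
      rw [mul_comm, mul_smul]; exact AddSubmonoid.nsmul_mem Q hna m
    have h2 : (n * m) • b ∈ Q := by
      rw [mul_smul]; exact AddSubmonoid.nsmul_mem Q hmb n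
    rw [smul_add]; exact Q.add_mem h1 h2

/-- `Q` is contained in its normalization. -/
theorem le_sat {N : ℕ} (Q : AddSubmonoid (ZN N)) : Q ≤ sat Q := fun q hq =>
  ⟨AddSubgroup.subset_closure hq, 1, le_refl 1, by simpa using hq⟩

/-- The set of holes `sat(Q) ∖ Q`. -/
def holes {N : ℕ} (Q : AddSubmonoid (ZN N)) : Set (ZN N) :=
  (sat Q : Set (ZN N)) \ (Q : Set (ZN N))

/-- The localization `Q_F = {q - f : q ∈ Q, f ∈ F}`. -/
def loc {N : ℕ} (Q F : AddSubmonoid (ZN N)) : AddSubmonoid (ZN N) where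
  carrier := {x | ∃ q ∈ Q, ∃ f ∈ F, x = q - f}
  zero_mem' := ⟨0, Q.zero_mem, 0, F.zero_mem, by simp⟩
  add_mem' := by
    rintro a b ⟨q, hq, f, hf, rfl⟩ ⟨q', hq', f', hf', rfl⟩
    exact ⟨q + q', Q.add_mem hq hq', f + f', F.add_mem hf hf', by ring⟩

/-- `F` is a maximal face (w.r.t. inclusion) among the faces `G` of `Q` with
`G + m ⊆ D`. -/
def IsMaxFaceFor {N : ℕ} (Q : AddSubmonoid (ZN N)) (D : Set (ZN N))
    (F : AddSubmonoid (ZN N)) (m : ZN N) : Prop :=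
  IsFace Q F ∧ (∀ f ∈ F, f + m ∈ D) ∧
    ∀ G : AddSubmonoid (ZN N), IsFace Q G → (∀ g ∈ G, g + m ∈ D) → F ≤ G → G = F

/-- `gp(F) + q` is a family of holes of `Q` (with the face `F` and base point `q`). -/
def IsFamilyOfHolesWith {N : ℕ} (Q F : AddSubmonoid (ZN N)) (q : ZN N) : Prop :=
  q ∈ holes Q ∧ IsMaxFaceFor Q (holes Q) F q

/-- `S ⊆ gp(Q)` is a family of holes of `Q`. -/
def IsFamilyOfHoles {N : ℕ} (Q : AddSubmonoid (ZN N)) (S : Set (ZN N)) : Prop :=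
  ∃ (q : ZN N) (F : AddSubmonoid (ZN N)), IsFamilyOfHolesWith Q F q ∧
    S = (fun f => f + q) '' (gp F : Set (ZN N))

/-- `M ⊆ gp(Q)` is a `Q`-module. -/
def IsQModule {N : ℕ} (Q : AddSubmonoid (ZN N)) (M : Set (ZN N)) : Prop :=
  M ⊆ (gp Q : Set (ZN N)) ∧ ∀ q ∈ Q, ∀ m ∈ M, q + m ∈ M

/-- `M` is a finitely generated `Q`-module: a finite union of translates of `Q`. -/
def IsFGQModule {N : ℕ} (Q : AddSubmonoid (ZN N)) (M : Set (ZN N)) : Prop :=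
  IsQModule Q M ∧ ∃ s : Finset (ZN N), ↑s ⊆ M ∧
    M = ⋃ m ∈ s, {x | ∃ q ∈ Q, x = m + q}

/-- The rank of a subgroup of `ℤ^N`. -/
noncomputable def rk {N : ℕ} (A : AddSubgroup (ZN N)) : ℕ :=
  Module.finrank ℤ (AddSubgroup.toIntSubmodule A)

/-- The face `F₀` of units of `Q`. -/
def unitsFace {N : ℕ} (Q : AddSubmonoid (ZN N)) : AddSubmonoid (ZN N) where
  carrier := {q | q ∈ Q ∧ -q ∈ Q}
  zero_mem' := ⟨Q.zero_mem, by simpa using Q.zero_mem⟩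
  add_mem' := by
    rintro a b ⟨ha, ha'⟩ ⟨hb, hb'⟩
    exact ⟨Q.add_mem ha hb, by rw [neg_add]; exact Q.add_mem ha' hb'⟩

/-- The *dimension of a face `F` of `Q`: `rank gp(F) - rank gp(F₀)`. -/
noncomputable def sdim {N : ℕ} (Q F : AddSubmonoid (ZN N)) : ℕ :=
  rk (gp F) - rk (gp (unitsFace Q))

/-- The *dimension of `Q`: `rank gp(Q) - rank gp(F₀)`. -/
noncomputable def sdimQ {N : ℕ} (Q : AddSubmonoid (ZN N)) : ℕ :=
  rk (gp Q) - rk (gp (unitsFace Q))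

/-- `Q` is seminormal: `2q, 3q ∈ Q` implies `q ∈ Q` for `q ∈ gp(Q)`. -/
def Seminormal {N : ℕ} (Q : AddSubmonoid (ZN N)) : Prop :=
  ∀ q ∈ gp Q, (2 : ℕ) • q ∈ Q → (3 : ℕ) • q ∈ Q → q ∈ Q

/-- The canonical embedding `ℤ^N → ℚ^N`. -/
def toQ {N : ℕ} (x : ZN N) : Fin N → ℚ := fun i => (x i : ℚ)

/-- The `ℚ`-linear span of (the image in `ℚ^N` of) a submonoid `F` of `ℤ^N`. -/
def qspan {N : ℕ} (F : AddSubmonoid (ZN N)) : Submodule ℚ (Fin N → ℚ) :=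
  Submodule.span ℚ (toQ '' (F : Set (ZN N)))

section Rank

variable {N : ℕ}

theorem rk_mono {A B : AddSubgroup (ZN N)} (h : A ≤ B) : rk A ≤ rk B :=
  Submodule.finrank_mono (AddSubgroup.toIntSubmodule.monotone h)

/-- If every element of `B` has a nonzero multiple in `A`, then `rk B ≤ rk A`. -/
theorem rk_le_of_forall_exists_smul_mem {A B : AddSubgroup (ZN N)}
    (h : ∀ z ∈ B, ∃ a : ℤ, a ≠ 0 ∧ a • z ∈ A) : rk B ≤ rk A := by
  by_contra! hlt
  let A' := AddSubgroup.toIntSubmodule A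
  let B' := AddSubgroup.toIntSubmodule B
  have hle : Module.finrank ℤ (A'.comap B'.subtype) ≤ Module.finrank ℤ A' := by
    have h1 := Submodule.finrank_map_subtype_eq B' (A'.comap B'.subtype)
    rw [← h1]
    exact Submodule.finrank_mono (Submodule.map_comap_le _ _)
  have hlt' : Module.rank ℤ (A'.comap B'.subtype) < Module.rank ℤ B' := by
    rw [← Submodule.finrank_eq_rank, ← Module.finrank_eq_rank]
    exact_mod_cast hle.trans_lt hlt
  obtain ⟨⟨m, hm⟩, hmA⟩ := Submodule.exists_smul_notMem_of_rank_lt hlt'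
  obtain ⟨a, ha, haA⟩ := h m hm
  exact hmA a ha haA

theorem rk_closure_singleton_le (y : ZN N) : rk (AddSubgroup.closure {y}) ≤ 1 := by
  unfold rk
  rw [AddSubgroup.toIntSubmodule_closure]
  exact (finrank_span_le_card ({y} : Set (ZN N))).trans (by simp)

theorem rk_closure_singleton_pos {y : ZN N} (hy : y ≠ 0) :
    1 ≤ rk (AddSubgroup.closure {y}) := by
  unfold rk
  rw [AddSubgroup.toIntSubmodule_closure, Nat.one_le_iff_ne_zero]
  intro h
  rw [Submodule.finrank_eq_zero, Submodule.span_singleton_eq_bot] at h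
  exact hy h

theorem rk_sup_add_rk_inf (A B : AddSubgroup (ZN N)) :
    rk (A ⊔ B) + rk (A ⊓ B) = rk A + rk B := by
  have h := Submodule.rank_sup_add_rank_inf_eq (AddSubgroup.toIntSubmodule A)
    (AddSubgroup.toIntSubmodule B)
  rw [← OrderIso.map_sup, ← OrderIso.map_inf] at h
  simp only [← Submodule.finrank_eq_rank] at h
  exact_mod_cast h

theorem rk_lt_of_forall_smul_notMem {A B : AddSubgroup (ZN N)} (hAB : A ≤ B) {y : ZN N}
    (hy : y ∈ B) (h : ∀ n : ℤ, n ≠ 0 → n • y ∉ A) : rk A < rk B := by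
  have hy0 : y ≠ 0 := by
    rintro rfl
    exact h 1 one_ne_zero (by simp)
  have hinf : A ⊓ AddSubgroup.closure {y} = ⊥ := by
    rw [eq_bot_iff]
    rintro z ⟨hzA, hz⟩
    obtain ⟨n, rfl⟩ := AddSubgroup.mem_closure_singleton.1 hz
    by_cases hn : n = 0
    · simp [hn]
    · exact absurd hzA (h n hn)
  have h1 := rk_sup_add_rk_inf A (AddSubgroup.closure {y})
  have h2 := rk_closure_singleton_pos hy0
  have h3 : rk (⊥ : AddSubgroup (ZN N)) = 0 := by simp [rk]
  have h4 : rk (A ⊔ AddSubgroup.closure {y}) ≤ rk B :=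
    rk_mono (sup_le hAB (by simpa using hy))
  rw [hinf, h3] at h1
  omega

theorem rk_le_add_one {A B : AddSubgroup (ZN N)} {y : ZN N}
    (h : ∀ z ∈ B, ∃ a : ℤ, a ≠ 0 ∧ ∃ b : ℤ, a • z - b • y ∈ A) : rk B ≤ rk A + 1 := by
  have h1 := rk_sup_add_rk_inf A (AddSubgroup.closure {y})
  have h2 := rk_closure_singleton_le y
  have h3 : rk B ≤ rk (A ⊔ AddSubgroup.closure {y}) := by
    refine rk_le_of_forall_exists_smul_mem fun z hz => ?_
    obtain ⟨a, ha, b, hab⟩ := h z hz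
    refine ⟨a, ha, ?_⟩
    rw [← sub_add_cancel (a • z) (b • y)]
    exact AddSubgroup.add_mem_sup hab (AddSubgroup.mem_closure_singleton.2 ⟨b, rfl⟩)
  omega

end Rank

section Slope

/-- In a finitely generated submonoid of `ℕ × ℕ` meeting the vertical axis only in the origin,
a slope is attained that is maximal among all elements. -/
theorem exists_max_slope {M : AddSubmonoid (ℕ × ℕ)} (hM : M.FG) (h1 : ∃ m ∈ M, 0 < m.1)
    (h0 : ∀ b, (0, b) ∈ M → b = 0) :
    ∃ t ∈ M, 0 < t.1 ∧ ∀ m ∈ M, m.2 * t.1 ≤ t.2 * m.1 := by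
  obtain ⟨T, rfl⟩ := hM
  have hne : (T.filter fun t => 0 < t.1).Nonempty := by
    by_contra! hT
    obtain ⟨m, hm, hm1⟩ := h1
    have hle : AddSubmonoid.closure (T : Set (ℕ × ℕ)) ≤
        AddMonoidHom.mker (AddMonoidHom.fst ℕ ℕ) := by
      rw [AddSubmonoid.closure_le]
      intro t ht
      have : t ∉ T.filter fun t => 0 < t.1 := by simp [hT]
      change t.1 = 0
      simpa [Finset.mem_coe.1 ht] using this
    exact hm1.ne' (hle hm)
  obtain ⟨t, ht, hmax⟩ := Finset.exists_max_image _ (fun t => (t.2 : ℚ) / t.1) hne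
  rw [Finset.mem_filter] at ht
  refine ⟨t, AddSubmonoid.subset_closure ht.1, ht.2, fun m hm => ?_⟩
  induction hm using AddSubmonoid.closure_induction with
  | mem s hs =>
    rcases Nat.eq_zero_or_pos s.1 with hs1 | hs1
    · have : s.2 = 0 := h0 s.2 (by rw [← hs1]; exact AddSubmonoid.subset_closure hs)
      simp [this]
    · have := hmax s (Finset.mem_filter.2 ⟨hs, hs1⟩)
      have h2 := ht.2
      rw [div_le_div_iff₀ (by exact_mod_cast hs1) (by exact_mod_cast h2)] at this
      exact_mod_cast this
  | zero => simp
  | add a b _ _ ha hb =>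
    simp only [Prod.fst_add, Prod.snd_add]
    linarith

/-- A consequence of Gordan's lemma: the pairs `(a, b)` with `a • u + b • v ∈ P` form a finitely
generated monoid. -/
theorem fg_setOf_smul_add_smul_mem {G : Type*} [AddCommGroup G] {P : AddSubmonoid G} (hP : P.FG)
    (u v : G) : ∃ M : AddSubmonoid (ℕ × ℕ), M.FG ∧
      ∀ a b, (a, b) ∈ M ↔ a • u + b • v ∈ P := by
  classical
  obtain ⟨T, rfl⟩ := hP
  let φ : ((T → ℕ) × (ℕ × ℕ)) →+ G :=
    { toFun := fun c => ∑ t, c.1 t • (t : G)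
      map_zero' := by simp
      map_add' := fun x y => by simp [add_smul, Finset.sum_add_distrib] }
  let ψ : ((T → ℕ) × (ℕ × ℕ)) →+ G :=
    { toFun := fun c => c.2.1 • u + c.2.2 • v
      map_zero' := by simp
      map_add' := fun x y => by simp only [Prod.snd_add, Prod.fst_add, add_smul]; abel }
  refine ⟨(φ.eqLocusM ψ).map (AddMonoidHom.snd _ _),
    (AddSubmonoid.fg_eqLocusM φ ψ).map _, fun a b => ⟨?_, fun h => ?_⟩⟩
  · rintro ⟨⟨c, a', b'⟩, hc, heq⟩
    obtain ⟨rfl, rfl⟩ := Prod.mk.inj heq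
    have hc' : ∑ t, c t • (t : G) = a' • u + b' • v := hc
    rw [← hc']
    exact AddSubmonoid.sum_mem _ fun t _ =>
      AddSubmonoid.nsmul_mem _ (AddSubmonoid.subset_closure t.2) _
  · obtain ⟨f, -, hf⟩ := AddSubmonoid.mem_closure_finset.1 h
    refine ⟨(fun t => f t, a, b), ?_, rfl⟩
    change ∑ t : T, f t • (t : G) = a • u + b • v
    rw [← hf, Finset.sum_coe_sort T fun t => f t • t]

theorem exists_extreme_combination {G : Type*} [AddCommGroup G] {P : AddSubmonoid G} (hP : P.FG)
    {u v : G} (hu : u ∈ P) (hv : ∀ b : ℕ, b • v ∈ P → b = 0) :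
    ∃ a b : ℕ, 0 < a ∧ a • u + b • v ∈ P ∧
      ∀ n : ℕ, (n * a) • u + (n * b + 1) • v ∉ P := by
  obtain ⟨M, hM, hmem⟩ := fg_setOf_smul_add_smul_mem hP u v
  obtain ⟨⟨a, b⟩, ht, hpos, hmax⟩ := exists_max_slope hM
    ⟨(1, 0), (hmem 1 0).2 (by simpa using hu), one_pos⟩
    fun b hb => hv b (by simpa using (hmem 0 b).1 hb)
  refine ⟨a, b, hpos, (hmem a b).1 ht, fun n hn => ?_⟩
  have := hmax _ ((hmem _ _).2 hn)
  simp only at this hpos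
  nlinarith

end Slope

section Face

variable {N : ℕ} {Q F G H : AddSubmonoid (ZN N)}

theorem le_gp (Q : AddSubmonoid (ZN N)) {q : ZN N} (hq : q ∈ Q) : q ∈ gp Q :=
  AddSubgroup.subset_closure hq

theorem gp_mono (h : F ≤ G) : gp F ≤ gp G :=
  AddSubgroup.closure_mono h

theorem mem_gp_iff {x : ZN N} : x ∈ gp Q ↔ ∃ a ∈ Q, ∃ b ∈ Q, x = a - b := by
  refine ⟨fun h => ?_, ?_⟩
  · induction h using AddSubgroup.closure_induction with
    | mem x hx => exact ⟨x, hx, 0, Q.zero_mem, by simp⟩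
    | zero => exact ⟨0, Q.zero_mem, 0, Q.zero_mem, by simp⟩
    | add x y _ _ hx hy =>
      obtain ⟨a, ha, b, hb, rfl⟩ := hx
      obtain ⟨c, hc, d, hd, rfl⟩ := hy
      exact ⟨a + c, Q.add_mem ha hc, b + d, Q.add_mem hb hd, by abel⟩
    | neg x _ hx =>
      obtain ⟨a, ha, b, hb, rfl⟩ := hx
      exact ⟨b, hb, a, ha, by abel⟩
  · rintro ⟨a, ha, b, hb, rfl⟩
    exact (gp Q).sub_mem (le_gp Q ha) (le_gp Q hb)

theorem loc_mono_right (h : F ≤ G) : loc Q F ≤ loc Q G := by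
  rintro x ⟨q, hq, f, hf, rfl⟩
  exact ⟨q, hq, f, h hf, rfl⟩

theorem le_loc : Q ≤ loc Q F := fun q hq => ⟨q, hq, 0, F.zero_mem, by simp⟩

theorem fg_loc (hQ : Q.FG) (hF : F.FG) : (loc Q F).FG := by
  have : loc Q F = Q ⊔ F.map negAddMonoidHom := by
    ext x
    simp only [AddSubmonoid.mem_sup, AddSubmonoid.mem_map]
    constructor
    · rintro ⟨q, hq, f, hf, rfl⟩
      exact ⟨q, hq, -f, ⟨f, hf, rfl⟩, (sub_eq_add_neg q f).symm⟩
    · rintro ⟨q, hq, _, ⟨f, hf, rfl⟩, rfl⟩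
      exact ⟨q, hq, f, hf, (sub_eq_add_neg q f).symm⟩
  rw [this]
  exact hQ.sup (hF.map _)

theorem isFace_self (Q : AddSubmonoid (ZN N)) : IsFace Q Q :=
  ⟨le_rfl, fun _ _ ha hb => ⟨fun _ => ⟨ha, hb⟩, fun _ => Q.add_mem ha hb⟩⟩

theorem isFace_unitsFace (Q : AddSubmonoid (ZN N)) : IsFace Q (unitsFace Q) := by
  refine ⟨fun q hq => hq.1, fun a b ha hb => ⟨fun h => ⟨⟨ha, ?_⟩, ⟨hb, ?_⟩⟩, fun h =>
    (unitsFace Q).add_mem h.1 h.2⟩⟩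
  · have := Q.add_mem h.2 hb
    rwa [neg_add, neg_add_cancel_right] at this
  · have := Q.add_mem h.2 ha
    rwa [neg_add_rev, neg_add_cancel_right] at this

namespace IsFace

theorem of_add_left (hF : IsFace Q F) {a b : ZN N} (ha : a ∈ Q) (hb : b ∈ Q) (h : a + b ∈ F) :
    a ∈ F :=
  ((hF.2 a b ha hb).1 h).1

theorem of_nsmul (hF : IsFace Q F) {a : ZN N} (ha : a ∈ Q) {n : ℕ} (hn : 0 < n)
    (h : n • a ∈ F) : a ∈ F := by
  obtain ⟨m, rfl⟩ : ∃ m, n = m + 1 := ⟨n - 1, by omega⟩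
  rw [add_smul, one_smul, add_comm] at h
  exact hF.of_add_left ha (Q.nsmul_mem ha m) h

theorem trans (hG : IsFace Q G) (hF : IsFace G F) : IsFace Q F := by
  refine ⟨hF.1.trans hG.1, fun a b ha hb => ⟨fun h => ?_, fun h => F.add_mem h.1 h.2⟩⟩
  obtain ⟨ha', hb'⟩ := (hG.2 a b ha hb).1 (hF.1 h)
  exact (hF.2 a b ha' hb').1 h

theorem of_le (hF : IsFace Q F) (hG : G ≤ Q) (hFG : F ≤ G) : IsFace G F :=
  ⟨hFG, fun a b ha hb => hF.2 a b (hG ha) (hG hb)⟩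

theorem unitsFace_le (hF : IsFace Q F) : unitsFace Q ≤ F := fun q hq =>
  hF.of_add_left hq.1 hq.2 (by simp [F.zero_mem])

theorem eq_closure_inter {S : Set (ZN N)} (hS : AddSubmonoid.closure S = Q) (hF : IsFace Q F) :
    F = AddSubmonoid.closure (S ∩ F) := by
  subst hS
  refine le_antisymm (fun q hqF => ?_)
    ((AddSubmonoid.closure_mono Set.inter_subset_right).trans (AddSubmonoid.closure_eq F).le)
  have hq := hF.1 hqF
  revert hqF
  induction hq using AddSubmonoid.closure_induction with
  | mem x hx => exact fun h => AddSubmonoid.subset_closure ⟨hx, h⟩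
  | zero => exact fun _ => AddSubmonoid.zero_mem _
  | add x y hx hy ihx ihy =>
    intro h
    obtain ⟨hx', hy'⟩ := (hF.2 x y hx hy).1 h
    exact AddSubmonoid.add_mem _ (ihx hx') (ihy hy')

theorem fg (hQ : Q.FG) (hF : IsFace Q F) : F.FG := by
  obtain ⟨S, hS⟩ := hQ
  rw [hF.eq_closure_inter hS]
  exact (AddSubmonoid.fg_iff _).2 ⟨_, rfl, S.finite_toSet.inter_of_left _⟩

end IsFace

theorem finite_setOf_isFace (hQ : Q.FG) : {F | IsFace Q F}.Finite := by
  obtain ⟨S, hS⟩ := hQ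
  refine (S.finite_toSet.finite_subsets.image AddSubmonoid.closure).subset fun F hF => ?_
  exact ⟨_, Set.inter_subset_left, (IsFace.eq_closure_inter hS hF).symm⟩

/-- An affine monoid has an element that lies in no proper face. -/
theorem exists_mem_forall_isFace_eq (hQ : Q.FG) : ∃ y ∈ Q, ∀ F, IsFace Q F → y ∈ F → F = Q := by
  classical
  obtain ⟨S, rfl⟩ := hQ
  have hS : ∀ s ∈ S, s ∈ AddSubmonoid.closure (S : Set (ZN N)) := fun s hs =>
    AddSubmonoid.subset_closure hs
  refine ⟨∑ s ∈ S, s, AddSubmonoid.sum_mem _ hS, fun F hF hy => ?_⟩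
  refine le_antisymm hF.1 ((AddSubmonoid.closure_le).2 fun s hs => ?_)
  refine hF.of_add_left (hS s hs) (AddSubmonoid.sum_mem _ fun t ht => hS t ?_)
    (b := ∑ t ∈ S.erase s, t) (by rwa [Finset.add_sum_erase S (fun t => t) hs])
  exact Finset.mem_of_mem_erase ht

/-- The smallest face of `Q` containing `T`, if `T ≤ Q`. -/
def faceHull (Q T : AddSubmonoid (ZN N)) : AddSubmonoid (ZN N) where
  carrier := {q | q ∈ Q ∧ ∃ p ∈ Q, q + p ∈ T}
  zero_mem' := ⟨Q.zero_mem, 0, Q.zero_mem, by simp [T.zero_mem]⟩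
  add_mem' := by
    rintro a b ⟨ha, p, hp, hap⟩ ⟨hb, r, hr, hbr⟩
    refine ⟨Q.add_mem ha hb, p + r, Q.add_mem hp hr, ?_⟩
    rw [add_add_add_comm]
    exact T.add_mem hap hbr

theorem isFace_faceHull (Q T : AddSubmonoid (ZN N)) : IsFace Q (faceHull Q T) := by
  refine ⟨fun q hq => hq.1, fun a b ha hb => ⟨?_, fun h => AddSubmonoid.add_mem _ h.1 h.2⟩⟩
  rintro ⟨-, p, hp, h⟩
  refine ⟨⟨ha, b + p, Q.add_mem hb hp, ?_⟩, ⟨hb, a + p, Q.add_mem ha hp, ?_⟩⟩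
  · rwa [← add_assoc]
  · rwa [← add_assoc, add_comm b a]

theorem le_faceHull {T : AddSubmonoid (ZN N)} (hT : T ≤ Q) : T ≤ faceHull Q T := fun t ht =>
  ⟨hT ht, 0, Q.zero_mem, by simpa using ht⟩

theorem IsFace.smul_notMem_gp (hF : IsFace Q F) {y : ZN N} (hyQ : y ∈ Q) (hyF : y ∉ F) {n : ℤ}
    (hn : n ≠ 0) : n • y ∉ gp F := by
  intro h
  have h' : n.natAbs • y ∈ gp F := by
    rcases Int.natAbs_eq n with e | e <;> rw [e] at h
    · simpa using h
    · simpa using h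
  obtain ⟨a, ha, b, hb, hab⟩ := mem_gp_iff.1 h'
  refine hyF (hF.of_nsmul hyQ (Int.natAbs_pos.2 hn)
    (hF.of_add_left (Q.nsmul_mem hyQ _) (hF.1 hb) ?_))
  rwa [hab, sub_add_cancel]

theorem IsFace.rk_lt (hF : IsFace Q F) (hne : F ≠ Q) : rk (gp F) < rk (gp Q) := by
  obtain ⟨y, hyQ, hyF⟩ := SetLike.exists_of_lt (lt_of_le_of_ne hF.1 hne)
  exact rk_lt_of_forall_smul_notMem (gp_mono hF.1) (le_gp Q hyQ) fun n hn =>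
    hF.smul_notMem_gp hyQ hyF hn

/-- A maximal proper face is a facet. -/
theorem IsFace.rk_add_one_of_maximal (hQ : Q.FG) (hF : IsFace Q F) (hne : F ≠ Q)
    (hmax : ∀ H, IsFace Q H → F ≤ H → H ≠ Q → H = F) : rk (gp Q) = rk (gp F) + 1 := by
  refine le_antisymm ?_ (hF.rk_lt hne)
  obtain ⟨y, hyQ, hyF⟩ := SetLike.exists_of_lt (lt_of_le_of_ne hF.1 hne)
  have key : ∀ z ∈ Q, ∃ a : ℤ, a ≠ 0 ∧ ∃ b : ℤ, a • z - b • y ∈ gp F := by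
    intro z hz
    obtain ⟨a, b, ha, ⟨g, hg, f, hf, hgf⟩, hext⟩ :=
      exists_extreme_combination (fg_loc hQ (hF.fg hQ)) (le_loc hz) (v := -y) (by
        rintro b ⟨g, hg, f, hf, hb⟩
        by_contra hb0
        refine hyF (hF.of_nsmul hyQ (Nat.pos_of_ne_zero hb0)
          (hF.of_add_left (Q.nsmul_mem hyQ b) hg ?_))
        have : b • y + g = f := by
          rw [smul_neg, neg_eq_iff_eq_neg, neg_sub] at hb
          rw [hb, sub_add_cancel]
        rwa [this])
    let H := faceHull Q (F ⊔ AddSubmonoid.multiples g)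
    have hle : F ⊔ AddSubmonoid.multiples g ≤ Q :=
      sup_le hF.1 (AddSubmonoid.multiples_le.2 hg)
    have hHF : H = F := by
      refine hmax H (isFace_faceHull _ _) (le_sup_left.trans (le_faceHull hle)) fun hHQ => ?_
      obtain ⟨-, p, hp, hyp⟩ : y ∈ H := hHQ ▸ hyQ
      obtain ⟨f', hf', _, ⟨n, rfl⟩, hn⟩ := AddSubmonoid.mem_sup.1 hyp
      refine hext n ⟨p, hp, f' + n • f, F.add_mem hf' (F.nsmul_mem hf n), ?_⟩
      have e : (n * a) • z + (n * b + 1) • -y = n • (a • z + b • -y) - y := by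
        simp only [smul_add, mul_smul, add_smul, one_smul]
        abel
      have e2 : p = f' + n • g - y := by
        rw [eq_sub_iff_add_eq, hn, add_comm]
      rw [e, hgf, e2, smul_sub]
      abel
    have hgF : g ∈ F :=
      hHF ▸ le_faceHull hle (AddSubmonoid.mem_sup_right (AddSubmonoid.mem_multiples g))
    refine ⟨a, by exact_mod_cast ha.ne', b, ?_⟩
    have : (a : ℤ) • z - (b : ℤ) • y = g - f := by
      rw [← hgf, natCast_zsmul, natCast_zsmul, smul_neg, sub_eq_add_neg]
    rw [this]
    exact (gp F).sub_mem (le_gp F hgF) (le_gp F hf)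
  refine rk_le_add_one (y := y) fun z hz => ?_
  obtain ⟨z₁, hz₁, z₂, hz₂, rfl⟩ := mem_gp_iff.1 hz
  obtain ⟨a₁, ha₁, b₁, h₁⟩ := key z₁ hz₁
  obtain ⟨a₂, ha₂, b₂, h₂⟩ := key z₂ hz₂
  refine ⟨a₁ * a₂, mul_ne_zero ha₁ ha₂, a₂ * b₁ - a₁ * b₂, ?_⟩
  have : (a₁ * a₂) • (z₁ - z₂) - (a₂ * b₁ - a₁ * b₂) • y =
      a₂ • (a₁ • z₁ - b₁ • y) - a₁ • (a₂ • z₂ - b₂ • y) := by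
    ext j
    simp only [Pi.sub_apply, Pi.smul_apply, smul_eq_mul]
    ring
  rw [this]
  exact (gp F).sub_mem ((gp F).zsmul_mem h₁ _) ((gp F).zsmul_mem h₂ _)

theorem IsFace.exists_facet_ge (hQ : Q.FG) (hF : IsFace Q F) (hne : F ≠ Q) :
    ∃ G, IsFace Q G ∧ F ≤ G ∧ G ≠ Q ∧ rk (gp Q) = rk (gp G) + 1 := by
  have hfin : {G | IsFace Q G ∧ G ≠ Q}.Finite :=
    (finite_setOf_isFace hQ).subset fun G hG => hG.1
  obtain ⟨G, hFG, hG⟩ := hfin.exists_le_maximal (a := F) ⟨hF, hne⟩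
  exact ⟨G, hG.prop.1, hFG, hG.prop.2, hG.prop.1.rk_add_one_of_maximal hQ hG.prop.2
    fun H hH hGH hHQ => (hG.eq_of_le ⟨hH, hHQ⟩ hGH).symm⟩

theorem IsFace.rk_gp_eq (hF : IsFace Q F) : rk (gp F) = sdim Q F + rk (gp (unitsFace Q)) := by
  have := rk_mono (gp_mono hF.unitsFace_le)
  unfold sdim
  omega

theorem IsFace.exists_face_sdim_eq (hQ : Q.FG) {k : ℕ} (hG : IsFace Q G) (hk : k ≤ sdim Q G) :
    ∃ F, IsFace Q F ∧ F ≤ G ∧ sdim Q F = k := by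
  induction h : sdim Q G - k generalizing G with
  | zero => exact ⟨G, hG, le_rfl, by omega⟩
  | succ n ih =>
    have hU : IsFace G (unitsFace Q) :=
      (isFace_unitsFace Q).of_le hG.1 hG.unitsFace_le
    have hne : unitsFace Q ≠ G := by
      rintro rfl
      have : sdim Q (unitsFace Q) = 0 := Nat.sub_self _
      omega
    obtain ⟨F, hF, -, -, hrk⟩ := hU.exists_facet_ge (hG.fg hQ) hne
    have h1 := hG.rk_gp_eq
    have h2 := (hG.trans hF).rk_gp_eq
    obtain ⟨F', hF', hle, hd⟩ := ih (hG.trans hF) (by omega) (by omega)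
    exact ⟨F', hF', hle.trans hF.1, hd⟩

/-- An element lying in the localizations at all facets lies in the normalization. -/
theorem mem_sat_of_forall_mem_loc (hQ : Q.FG) {x : ZN N} (hx : x ∈ gp Q)
    (h : ∀ G, IsFace Q G → rk (gp Q) = rk (gp G) + 1 → x ∈ loc Q G) : x ∈ sat Q := by
  obtain ⟨y, hyQ, hy⟩ := exists_mem_forall_isFace_eq hQ
  by_contra hsat
  obtain ⟨a, b, ha, hz, hext⟩ := exists_extreme_combination hQ hyQ (v := x) (by
    intro b hb
    by_contra hb0
    exact hsat ⟨hx, b, Nat.one_le_iff_ne_zero.2 hb0, hb⟩)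
  have hle : AddSubmonoid.multiples (a • y + b • x) ≤ Q := AddSubmonoid.multiples_le.2 hz
  have hne : faceHull Q (AddSubmonoid.multiples (a • y + b • x)) ≠ Q := by
    intro hHQ
    obtain ⟨q₁, hq₁, q₂, hq₂, hq⟩ := mem_gp_iff.1 hx
    rw [← hHQ] at hq₂
    obtain ⟨-, p, hp, n, hn⟩ := hq₂
    refine hext n ?_
    have : (n * a) • y + (n * b + 1) • x = q₁ + p := by
      have e : (n * a) • y + (n * b + 1) • x = n • (a • y + b • x) + x := by
        simp only [smul_add, mul_smul, add_smul, one_smul]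
        abel
      simp only at hn
      rw [e, hn, hq]
      abel
    rw [this]
    exact Q.add_mem hq₁ hp
  obtain ⟨G, hG, hHG, hGQ, hrk⟩ := (isFace_faceHull Q _).exists_facet_ge hQ hne
  obtain ⟨q, hq, g, hg, hxq⟩ := h G hG hrk
  refine hGQ (hy G hG (hG.of_nsmul hyQ ha
    (hG.of_add_left (Q.nsmul_mem hyQ a) (Q.nsmul_mem hq b) ?_)))
  have : a • y + b • q = (a • y + b • x) + b • g := by
    rw [hxq, smul_sub]
    abel
  rw [this]
  exact G.add_mem (hHG (le_faceHull hle (AddSubmonoid.mem_multiples _))) (G.nsmul_mem hg b)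

/-- If `F` is maximal among the faces `G` with `G + q` consisting of holes, then every face not
contained in `F` has a localization that meets `q + F`. -/
theorem IsFamilyOfHolesWith.exists_add_mem_loc {q : ZN N} (hq : IsFamilyOfHolesWith Q F q)
    (hG : IsFace Q G) (hGF : ¬ G ≤ F) : ∃ f ∈ F, q + f ∈ loc Q G := by
  obtain ⟨hqh, hF, -, hmax⟩ := hq
  by_contra! hno
  have hle : F ⊔ G ≤ Q := sup_le hF.1 hG.1
  have hFG := le_faceHull hle
  refine hGF ?_
  rw [← hmax (faceHull Q (F ⊔ G)) (isFace_faceHull _ _) ?_ (le_sup_left.trans hFG)]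
  · exact le_sup_right.trans hFG
  rintro h ⟨hh, p, hp, hhp⟩
  refine ⟨(sat Q).add_mem (le_sat Q hh) hqh.1, fun hmem => ?_⟩
  obtain ⟨f, hf, g, hg, hfg⟩ := AddSubmonoid.mem_sup.1 hhp
  refine hno f hf ⟨h + q + p, Q.add_mem hmem hp, g, hg, ?_⟩
  rw [eq_sub_iff_add_eq, add_assoc, hfg]
  abel

end Face

/-- For `0 ≤ i ≤ d - 2` the intersection of the localizations at the
`i`-*dimensional faces is contained in the intersection of the localizations at the
`(i+1)`-*dimensional faces, and the inclusion is strict iff `Q` has an `i`-*dimensional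
family of holes. -/
theorem inter_loc_mono {N : ℕ} (Q : AddSubmonoid (ZN N)) (hQ : Q.FG)
    (i : ℕ) (hi : i + 2 ≤ sdimQ Q) :
    (⋂ G ∈ {G : AddSubmonoid (ZN N) | IsFace Q G ∧ sdim Q G = i},
        (loc Q G : Set (ZN N))) ⊆
      (⋂ G ∈ {G : AddSubmonoid (ZN N) | IsFace Q G ∧ sdim Q G = i + 1},
        (loc Q G : Set (ZN N))) ∧
    ((⋂ G ∈ {G : AddSubmonoid (ZN N) | IsFace Q G ∧ sdim Q G = i},
        (loc Q G : Set (ZN N))) ⊂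
      (⋂ G ∈ {G : AddSubmonoid (ZN N) | IsFace Q G ∧ sdim Q G = i + 1},
        (loc Q G : Set (ZN N))) ↔
      ∃ (q : ZN N) (F : AddSubmonoid (ZN N)),
        IsFamilyOfHolesWith Q F q ∧ sdim Q F = i) := by
  have hmono : ∀ (G : AddSubmonoid (ZN N)) (k : ℕ), IsFace Q G → k ≤ sdim Q G →
      (⋂ F ∈ {F : AddSubmonoid (ZN N) | IsFace Q F ∧ sdim Q F = k}, (loc Q F : Set (ZN N))) ⊆
        (loc Q G : Set (ZN N)) := by
    intro G k hG hk x hx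
    obtain ⟨F, hF, hFG, hd⟩ := hG.exists_face_sdim_eq hQ hk
    exact loc_mono_right hFG (Set.mem_iInter₂.1 hx F ⟨hF, hd⟩)
  have hsub : (⋂ G ∈ {G : AddSubmonoid (ZN N) | IsFace Q G ∧ sdim Q G = i},
        (loc Q G : Set (ZN N))) ⊆
      (⋂ G ∈ {G : AddSubmonoid (ZN N) | IsFace Q G ∧ sdim Q G = i + 1},
        (loc Q G : Set (ZN N))) := by
    refine Set.subset_iInter₂ fun G hG => hmono G i hG.1 ?_
    have := hG.2
    omega
  refine ⟨hsub, fun hss => ?_, ?_⟩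
  · obtain ⟨x, hx, hxi⟩ := Set.exists_of_ssubset hss
    obtain ⟨F, ⟨hF, hFi⟩, hxF⟩ : ∃ F, (IsFace Q F ∧ sdim Q F = i) ∧ x ∉ loc Q F := by
      simpa [and_assoc] using hxi
    have hxgp : x ∈ gp Q := by
      obtain ⟨q, hq, p, hp, rfl⟩ := hmono Q (i + 1) (isFace_self Q)
        (show i + 1 ≤ sdimQ Q by omega) hx
      exact (gp Q).sub_mem (le_gp Q hq) (le_gp Q hp)
    have hsat : x ∈ sat Q := by
      refine mem_sat_of_forall_mem_loc hQ hxgp fun G hG hrk => hmono G (i + 1) hG ?_ hx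
      have := hG.rk_gp_eq
      unfold sdimQ at hi
      omega
    have hholes : ∀ f ∈ F, f + x ∈ holes Q := fun f hf =>
      ⟨(sat Q).add_mem (le_sat Q (hF.1 hf)) hsat, fun hQx => hxF ⟨f + x, hQx, f, hf, by abel⟩⟩
    refine ⟨x, F, ⟨by simpa using hholes 0 F.zero_mem, hF, hholes, fun G hG hGx hFG => ?_⟩, hFi⟩
    by_contra hne
    have hlt := (hF.of_le hG.1 hFG).rk_lt (Ne.symm hne)
    have h1 := hF.rk_gp_eq
    have h2 := hG.rk_gp_eq
    obtain ⟨q, hq, g, hg, rfl⟩ := hmono G (i + 1) hG (by omega) hx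
    exact (hGx g hg).2 (by simpa using hq)
  · rintro ⟨q, F, hq, hFi⟩
    obtain ⟨-, hF, hholes, -⟩ := id hq
    have hfin : {G | IsFace Q G ∧ sdim Q G = i + 1}.Finite :=
      (finite_setOf_isFace hQ).subset fun G hG => hG.1
    have hex : ∀ G ∈ {G | IsFace Q G ∧ sdim Q G = i + 1}, ∃ f ∈ F, q + f ∈ loc Q G := by
      rintro G ⟨hG, hGi⟩
      refine hq.exists_add_mem_loc hG fun hle => ?_
      have := rk_mono (gp_mono hle)
      have := hF.rk_gp_eq
      have := hG.rk_gp_eq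
      omega
    choose! f hfF hfloc using hex
    classical
    have hsum : ∀ s ⊆ hfin.toFinset, ∑ G ∈ s, f G ∈ F := fun s hs =>
      F.sum_mem fun G hG => hfF G (hfin.mem_toFinset.1 (hs hG))
    refine (Set.ssubset_iff_of_subset hsub).2 ⟨q + ∑ G ∈ hfin.toFinset, f G, ?_, fun hmem => ?_⟩
    · refine Set.mem_iInter₂.2 fun G hG => ?_
      rw [← Finset.add_sum_erase _ _ (hfin.mem_toFinset.2 hG), ← add_assoc]
      exact (loc Q G).add_mem (hfloc G hG)
        (le_loc (hF.1 (hsum _ (Finset.erase_subset _ _))))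
    · obtain ⟨p, hp, g, hg, hpg⟩ := Set.mem_iInter₂.1 hmem F ⟨hF, hFi⟩
      refine (hholes _ (F.add_mem (hsum _ subset_rfl) hg)).2 ?_
      rw [eq_sub_iff_add_eq] at hpg
      rw [add_comm, ← add_assoc, hpg]
      exact hp
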